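/- Let P=(A,C) be a measuring R-pairing (A not necessarily unital) such that C is locally projective as an R-module and κ_P(A) ⊆ C* is dense with respect to the finite topology. Then: (i) every counital right C-comodule (M,ϱ_M), equipped with the induced A-action a·m = Σ m_{<0>}⟨a,m_{<1>}⟩, is a unital left A-module (A·M = M); (ii) the assignments (M,ϱ_M) ↦ (M, α_M^P∘ϱ_M) and (M,ρ_M) ↦ (M, (α_M^P)^{-1}∘ρ_M), acting as the identity on morphisms, are mutually inverse isomorphisms between the category of counital right C-comodules and the category of C-rational left A-modules. -/

import Mathlib

open TensorProduct

universe u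

/-- The canonical map `α^P_M : M ⊗ C → Hom(A, M)` associated to an `R`-pairing
`β : A → C → R`, sending `Σ mᵢ ⊗ cᵢ` to `a ↦ Σ ⟨a, cᵢ⟩ • mᵢ`. -/
noncomputable def alphaMap (R : Type u) [CommRing R]
    {A : Type u} [AddCommGroup A] [Module R A]
    {C : Type u} [AddCommGroup C] [Module R C]
    (β : A →ₗ[R] C →ₗ[R] R)
    (M : Type u) [AddCommGroup M] [Module R M] :
    (M ⊗[R] C) →ₗ[R] (A →ₗ[R] M) :=
  (dualTensorHom R A M) ∘ₗ
    (TensorProduct.comm R M (Module.Dual R A)).toLinearMap ∘ₗ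
    (TensorProduct.map LinearMap.id β.flip)

/-- `(A, C)` is a measuring pairing: `κ_P : A → C*` is multiplicative into the
convolution algebra `C*`. -/
def IsMeasuring (R : Type u) [CommRing R]
    {A : Type u} [NonUnitalRing A] [Module R A]
    {C : Type u} [AddCommGroup C] [Module R C] [Coalgebra R C]
    (β : A →ₗ[R] C →ₗ[R] R) : Prop :=
  ∀ a b : A,
    β (a * b) =
      (LinearMap.mul' R R) ∘ₗ (TensorProduct.map (β a) (β b)) ∘ₗ
        (Coalgebra.comul (R := R) (A := C))

/-- The rational submodule `Rat^C(M)` of a module with `A`-action `σ`. -/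
noncomputable def ratSubmodule (R : Type u) [CommRing R]
    {A : Type u} [AddCommGroup A] [Module R A]
    {C : Type u} [AddCommGroup C] [Module R C]
    (β : A →ₗ[R] C →ₗ[R] R)
    {M : Type u} [AddCommGroup M] [Module R M]
    (σ : A →ₗ[R] M →ₗ[R] M) : Submodule R M :=
  (LinearMap.range (alphaMap R β M)).comap σ.flip

/-- The `A`-action induced on a right `C`-comodule: `a • m = Σ m₍₀₎⟨a, m₍₁₎⟩`. -/
noncomputable def inducedAction (R : Type u) [CommRing R]
    {A : Type u} [AddCommGroup A] [Module R A]
    {C : Type u} [AddCommGroup C] [Module R C]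
    (β : A →ₗ[R] C →ₗ[R] R)
    {M : Type u} [AddCommGroup M] [Module R M]
    (ϱ : M →ₗ[R] M ⊗[R] C) : A →ₗ[R] M →ₗ[R] M :=
  ((alphaMap R β M) ∘ₗ ϱ).flip

/-- `ϱ : M → M ⊗ C` is a (coassociative, counital) right `C`-comodule structure. -/
def IsRightComodule (R : Type u) [CommRing R]
    {C : Type u} [AddCommGroup C] [Module R C] [Coalgebra R C]
    {M : Type u} [AddCommGroup M] [Module R M]
    (ϱ : M →ₗ[R] M ⊗[R] C) : Prop :=
  ((TensorProduct.assoc R M C C).toLinearMap ∘ₗ (TensorProduct.map ϱ LinearMap.id) ∘ₗ ϱ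
      = (TensorProduct.map LinearMap.id (Coalgebra.comul (R := R))) ∘ₗ ϱ)
  ∧ ∀ m : M,
      (TensorProduct.rid R M)
        ((TensorProduct.map LinearMap.id (Coalgebra.counit (R := R))) (ϱ m)) = m

/-- `ϱ : N → C ⊗ N` is a (coassociative, counital) left `C`-comodule structure. -/
def IsLeftComodule (R : Type u) [CommRing R]
    {C : Type u} [AddCommGroup C] [Module R C] [Coalgebra R C]
    {N : Type u} [AddCommGroup N] [Module R N]
    (ϱ : N →ₗ[R] C ⊗[R] N) : Prop :=
  ((TensorProduct.assoc R C C N).symm.toLinearMap ∘ₗ (TensorProduct.map LinearMap.id ϱ) ∘ₗ ϱ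
      = (TensorProduct.map (Coalgebra.comul (R := R)) LinearMap.id) ∘ₗ ϱ)
  ∧ ∀ n : N,
      (TensorProduct.lid R N)
        ((TensorProduct.map (Coalgebra.counit (R := R)) LinearMap.id) (ϱ n)) = n

/-- The cotensor product `M □_C N` as a submodule of `M ⊗ N`. -/
noncomputable def cotensor (R : Type u) [CommRing R]
    {C : Type u} [AddCommGroup C] [Module R C]
    {M : Type u} [AddCommGroup M] [Module R M]
    {N : Type u} [AddCommGroup N] [Module R N]
    (ϱM : M →ₗ[R] M ⊗[R] C) (ϱN : N →ₗ[R] C ⊗[R] N) : Submodule R (M ⊗[R] N) :=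
  LinearMap.ker
    ((TensorProduct.assoc R M C N).toLinearMap ∘ₗ (TensorProduct.map ϱM LinearMap.id)
      - (TensorProduct.map LinearMap.id ϱN))

/-- The right `A`-action induced on a left `C`-comodule: `n • a = Σ ⟨a, n₍₋₁₎⟩ n₍₀₎`. -/
noncomputable def rAct (R : Type u) [CommRing R]
    {A : Type u} [AddCommGroup A] [Module R A]
    {C : Type u} [AddCommGroup C] [Module R C]
    {N : Type u} [AddCommGroup N] [Module R N]
    (β : A →ₗ[R] C →ₗ[R] R) (ϱ : N →ₗ[R] C ⊗[R] N) (a : A) : N →ₗ[R] N :=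
  (TensorProduct.lid R N).toLinearMap ∘ₗ (TensorProduct.map (β a) LinearMap.id) ∘ₗ ϱ

/-- `Hom_{A-}(B, N)`: the `A`-linear maps `B → N`, where `B` is an `A`-module via `ξ`. -/
noncomputable def homA (R : Type u) [CommRing R]
    {A B N : Type u} [Ring A] [Algebra R A] [Ring B] [Algebra R B]
    [AddCommGroup N] [Module R N]
    (ξ : A →ₐ[R] B) (σN : A →ₗ[R] N →ₗ[R] N) : Submodule R (B →ₗ[R] N) where
  carrier := {f | ∀ (a : A) (b : B), f (ξ a * b) = σN a (f b)}
  zero_mem' := by intro a b; simp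
  add_mem' := by intro f g hf hg a b; simp [hf a b, hg a b]
  smul_mem' := by intro r f hf a b; simp [hf a b]

/-- Evaluation at `1_B` as a linear map on a submodule of `Hom_R(B, N)`. -/
noncomputable def evalAtOne {R B N : Type u} [CommRing R] [Ring B] [Algebra R B]
    [AddCommGroup N] [Module R N] (Hsub : Submodule R (B →ₗ[R] N)) : ↥Hsub →ₗ[R] N where
  toFun f := (f : B →ₗ[R] N) 1
  map_add' f g := by simp
  map_smul' r f := by simp

namespace SliceMap

variable {R : Type u} [CommRing R] {A C M N : Type u}
  [AddCommGroup C] [Module R C] [AddCommGroup M] [Module R M] [AddCommGroup N] [Module R N]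

/-- The slice map `M ⊗ C → M`, `m ⊗ c ↦ f c • m`, of a functional `f` on `C`. -/
noncomputable def slice (M : Type u) [AddCommGroup M] [Module R M] (f : C →ₗ[R] R) :
    M ⊗[R] C →ₗ[R] M :=
  (TensorProduct.rid R M).toLinearMap ∘ₗ TensorProduct.map LinearMap.id f

@[simp]
lemma slice_tmul (f : C →ₗ[R] R) (m : M) (c : C) : slice M f (m ⊗ₜ c) = f c • m := by
  simp [slice]

lemma alphaMap_apply [AddCommGroup A] [Module R A] (β : A →ₗ[R] C →ₗ[R] R)
    (t : M ⊗[R] C) (a : A) : alphaMap R β M t a = slice M (β a) t := by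
  induction t with
  | zero => simp
  | tmul m c => simp [alphaMap]
  | add x y hx hy => simp [hx, hy]

lemma inducedAction_apply [AddCommGroup A] [Module R A] (β : A →ₗ[R] C →ₗ[R] R)
    (ϱ : M →ₗ[R] M ⊗[R] C) (a : A) (m : M) :
    inducedAction R β ϱ a m = slice M (β a) (ϱ m) :=
  alphaMap_apply β (ϱ m) a

lemma slice_map (g : C →ₗ[R] R) (h : M →ₗ[R] N) (t : M ⊗[R] C) :
    slice N g (TensorProduct.map h LinearMap.id t) = h (slice M g t) := by
  induction t with
  | zero => simp
  | tmul m c => simp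
  | add x y hx hy => simp [hx, hy]

lemma slice_assoc_symm_tmul {D : Type u} [AddCommGroup D] [Module R D]
    (g : D →ₗ[R] R) (m : M) (x : C ⊗[R] D) :
    slice (M ⊗[R] C) g ((TensorProduct.assoc R M C D).symm (m ⊗ₜ x)) = m ⊗ₜ slice C g x := by
  induction x with
  | zero => simp
  | tmul c d => simp
  | add x y hx hy => simp [TensorProduct.tmul_add, hx, hy]

lemma mul'_map_apply (f g : C →ₗ[R] R) (x : C ⊗[R] C) :
    LinearMap.mul' R R (TensorProduct.map f g x) = f (slice C g x) := by
  induction x with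
  | zero => simp
  | tmul c d => simp [mul_comm]
  | add x y hx hy => simp [hx, hy]

/-- A slice map only depends on the values of the functional on a finite set. -/
lemma exists_finset_slice_eq (f : C →ₗ[R] R) (t : M ⊗[R] C) :
    ∃ s : Finset C, ∀ g : C →ₗ[R] R, (∀ c ∈ s, g c = f c) → slice M g t = slice M f t := by
  classical
  induction t with
  | zero => exact ⟨∅, by simp⟩
  | tmul m c => exact ⟨{c}, by simp +contextual⟩
  | add x y hx hy =>
    obtain ⟨s, hs⟩ := hx
    obtain ⟨s', hs'⟩ := hy
    refine ⟨s ∪ s', fun g hg => ?_⟩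
    rw [map_add, map_add, hs g fun c hc => hg c (Finset.mem_union_left _ hc),
      hs' g fun c hc => hg c (Finset.mem_union_right _ hc)]

section Coalgebra

variable [Coalgebra R C]

lemma slice_convolution (f g : C →ₗ[R] R) (t : M ⊗[R] C) :
    slice M (LinearMap.mul' R R ∘ₗ TensorProduct.map f g ∘ₗ Coalgebra.comul) t =
      slice M f (slice (M ⊗[R] C) g ((TensorProduct.assoc R M C C).symm
        (TensorProduct.map LinearMap.id Coalgebra.comul t))) := by
  induction t with
  | zero => simp
  | tmul m c => simp [slice_assoc_symm_tmul, mul'_map_apply]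
  | add x y hx hy => simp only [map_add, hx, hy]

lemma slice_counit_comul (t : M ⊗[R] C) :
    slice (M ⊗[R] C) Coalgebra.counit ((TensorProduct.assoc R M C C).symm
      (TensorProduct.map LinearMap.id Coalgebra.comul t)) = t := by
  induction t with
  | zero => simp
  | tmul m c =>
    have h : slice C Coalgebra.counit (Coalgebra.comul (R := R) c) = c := by
      have := Coalgebra.lTensor_counit_comul (R := R) c
      rw [LinearMap.lTensor] at this
      simp [slice, this]
    simp [slice_assoc_symm_tmul, h]
  | add x y hx hy => simp only [map_add, hx, hy]

end Coalgebra

section Dense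

variable [AddCommGroup A] [Module R A] {β : A →ₗ[R] C →ₗ[R] R}

/-- The α-condition passes from `(C*, C)` to a pairing that is dense in the finite topology. -/
lemma eq_of_slice_eq
    (hlp : Function.Injective
      (alphaMap R (LinearMap.id : Module.Dual R C →ₗ[R] (C →ₗ[R] R)) M))
    (hdense : ∀ (f : C →ₗ[R] R) (s : Finset C), ∃ a : A, ∀ c ∈ s, β a c = f c)
    {t t' : M ⊗[R] C} (h : ∀ a, slice M (β a) t = slice M (β a) t') : t = t' := by
  rw [← sub_eq_zero]
  refine (injective_iff_map_eq_zero _).1 hlp _ (LinearMap.ext fun f => ?_)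
  obtain ⟨s, hs⟩ := exists_finset_slice_eq f (t - t')
  obtain ⟨a, ha⟩ := hdense f s
  rw [alphaMap_apply, LinearMap.id_apply, ← hs _ ha, map_sub, h, sub_self, LinearMap.zero_apply]

end Dense

section Measuring

variable [NonUnitalRing A] [Module R A] [Coalgebra R C] {β : A →ₗ[R] C →ₗ[R] R}

/-- Coassociativity of a coaction makes the induced action associative. -/
lemma inducedAction_mul (hmeas : IsMeasuring R β) {ϱ : M →ₗ[R] M ⊗[R] C}
    (hϱ : IsRightComodule R ϱ) (a b : A) :
    inducedAction R β ϱ (a * b) = inducedAction R β ϱ a ∘ₗ inducedAction R β ϱ b := by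
  ext m
  have h := LinearMap.congr_fun hϱ.1 m
  simp only [LinearMap.comp_apply, LinearEquiv.coe_coe] at h
  rw [LinearMap.comp_apply, inducedAction_apply, inducedAction_apply, inducedAction_apply,
    hmeas, slice_convolution, ← h, LinearEquiv.symm_apply_apply, slice_map]

/-- By density, every element of a comodule is fixed by some element of `A`. -/
lemma exists_inducedAction_eq_self
    (hdense : ∀ (f : C →ₗ[R] R) (s : Finset C), ∃ a : A, ∀ c ∈ s, β a c = f c)
    {ϱ : M →ₗ[R] M ⊗[R] C} (hϱ : IsRightComodule R ϱ) (m : M) :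
    ∃ a : A, inducedAction R β ϱ a m = m := by
  obtain ⟨s, hs⟩ := exists_finset_slice_eq (Coalgebra.counit (R := R) (A := C)) (ϱ m)
  obtain ⟨a, ha⟩ := hdense Coalgebra.counit s
  exact ⟨a, by rw [inducedAction_apply, hs _ ha]; exact hϱ.2 m⟩

lemma inducedAction_flip_injective
    (hdense : ∀ (f : C →ₗ[R] R) (s : Finset C), ∃ a : A, ∀ c ∈ s, β a c = f c)
    {ϱ : M →ₗ[R] M ⊗[R] C} (hϱ : IsRightComodule R ϱ) :
    Function.Injective (inducedAction R β ϱ).flip := by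
  refine (injective_iff_map_eq_zero _).2 fun m hm => ?_
  obtain ⟨a, ha⟩ := exists_inducedAction_eq_self hdense hϱ m
  rw [← ha, ← LinearMap.flip_apply, hm, LinearMap.zero_apply]

/-- If the action induced by `ϱ` is associative and faithful on elements of `M`, then `ϱ` is
a coassociative and counital coaction. -/
lemma isRightComodule_of_inducedAction_mul (hmeas : IsMeasuring R β)
    (hlp : ∀ (X : Type u) [AddCommGroup X] [Module R X],
      Function.Injective (alphaMap R (LinearMap.id : Module.Dual R C →ₗ[R] (C →ₗ[R] R)) X))
    (hdense : ∀ (f : C →ₗ[R] R) (s : Finset C), ∃ a : A, ∀ c ∈ s, β a c = f c)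
    {ϱ : M →ₗ[R] M ⊗[R] C}
    (hmul : ∀ a b : A,
      inducedAction R β ϱ (a * b) = inducedAction R β ϱ a ∘ₗ inducedAction R β ϱ b)
    (hinj : Function.Injective (inducedAction R β ϱ).flip) :
    IsRightComodule R ϱ := by
  classical
  have key (a b : A) (m : M) : slice M (β a) (slice (M ⊗[R] C) (β b)
      ((TensorProduct.assoc R M C C).symm
        (TensorProduct.map LinearMap.id Coalgebra.comul (ϱ m)))) =
      slice M (β a) (ϱ (slice M (β b) (ϱ m))) := by
    rw [← slice_convolution, ← hmeas, ← inducedAction_apply, hmul, LinearMap.comp_apply,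
      inducedAction_apply, inducedAction_apply]
  refine ⟨LinearMap.ext fun m => ?_, fun m => ?_⟩
  · simp only [LinearMap.comp_apply, LinearEquiv.coe_coe]
    rw [← LinearEquiv.eq_symm_apply]
    refine eq_of_slice_eq (hlp _) hdense fun b => eq_of_slice_eq (hlp _) hdense fun a => ?_
    rw [key, slice_map]
  · change slice M Coalgebra.counit (ϱ m) = m
    refine hinj (LinearMap.ext fun b => ?_)
    obtain ⟨s, hs⟩ := exists_finset_slice_eq (Coalgebra.counit (R := R) (A := C)) (ϱ m)
    obtain ⟨s', hs'⟩ := exists_finset_slice_eq (Coalgebra.counit (R := R) (A := C))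
      ((TensorProduct.assoc R M C C).symm
        (TensorProduct.map LinearMap.id Coalgebra.comul (ϱ m)))
    obtain ⟨a, ha⟩ := hdense Coalgebra.counit (s ∪ s')
    rw [LinearMap.flip_apply, LinearMap.flip_apply, inducedAction_apply, inducedAction_apply,
      ← hs _ fun c hc => ha c (Finset.mem_union_left _ hc), ← key,
      hs' _ fun c hc => ha c (Finset.mem_union_right _ hc), slice_counit_comul]

end Measuring

end SliceMap

open SliceMap

/-- Let `P = (A,C)` be a measuring `R`-pairing (`A` not necessarily
unital) with `C` locally projective over `R` and `κ_P(A) ⊆ C*` dense in the finite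
topology. Then (i) every counital right `C`-comodule is a unital left `A`-module under the
induced action; (ii) `(M,ϱ) ↦ (M, α∘ϱ)` and `(M,ρ) ↦ (M, α⁻¹∘ρ)`, acting as the identity
on morphisms, are mutually inverse isomorphisms between the category of counital right
`C`-comodules and the category of `C`-rational left `A`-modules. -/
theorem counital_comodules_iso_rational_modules
    {R A C : Type u} [CommRing R]
    [NonUnitalRing A] [Module R A] [SMulCommClass R A A] [IsScalarTower R A A]
    [AddCommGroup C] [Module R C] [Coalgebra R C]
    (β : A →ₗ[R] C →ₗ[R] R)
    (hmeas : IsMeasuring R β)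
    -- `C` is locally projective: the pairing `(C*, C)` satisfies the α-condition
    (hlp : ∀ (X : Type u) [AddCommGroup X] [Module R X],
      Function.Injective (alphaMap R (LinearMap.id : Module.Dual R C →ₗ[R] (C →ₗ[R] R)) X))
    -- `κ_P(A) ⊆ C*` is dense in the finite topology
    (hdense : ∀ (f : C →ₗ[R] R) (s : Finset C), ∃ a : A, ∀ c ∈ s, β a c = f c) :
    -- (i) every counital right `C`-comodule is a unital left `A`-module
    (∀ (M : Type u) [AddCommGroup M] [Module R M], ∀ ϱ : M →ₗ[R] M ⊗[R] C,
      IsRightComodule R ϱ → Function.Injective ϱ →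
      ∀ m : M, m ∈ Submodule.span R
        {x : M | ∃ (a : A) (m' : M), inducedAction R β ϱ a m' = x})
    ∧
    -- (ii) a counital comodule gives a `C`-rational `A`-faithful module
    (∀ (M : Type u) [AddCommGroup M] [Module R M], ∀ ϱ : M →ₗ[R] M ⊗[R] C,
      IsRightComodule R ϱ → Function.Injective ϱ →
      (∀ a b : A,
          inducedAction R β ϱ (a * b) = (inducedAction R β ϱ a) ∘ₗ (inducedAction R β ϱ b))
      ∧ Function.Injective (inducedAction R β ϱ).flip
      ∧ (∀ m : M, (inducedAction R β ϱ).flip m ∈ LinearMap.range (alphaMap R β M)))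
    ∧
    -- (ii') conversely, every `C`-rational module comes from a unique counital comodule
    (∀ (M : Type u) [AddCommGroup M] [Module R M], ∀ σ : A →ₗ[R] M →ₗ[R] M,
      (∀ a b : A, σ (a * b) = (σ a) ∘ₗ (σ b)) →
      Function.Injective σ.flip →
      (∀ m : M, σ.flip m ∈ LinearMap.range (alphaMap R β M)) →
      ∃! ϱ : M →ₗ[R] M ⊗[R] C,
        IsRightComodule R ϱ ∧ Function.Injective ϱ ∧ inducedAction R β ϱ = σ)
    ∧
    -- the correspondence is the identity on morphisms: colinear = `A`-linear
    (∀ (M : Type u) [AddCommGroup M] [Module R M], ∀ ϱM : M →ₗ[R] M ⊗[R] C,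
     ∀ (N : Type u) [AddCommGroup N] [Module R N], ∀ ϱN : N →ₗ[R] N ⊗[R] C,
      IsRightComodule R ϱM → Function.Injective ϱM →
      IsRightComodule R ϱN → Function.Injective ϱN →
      ∀ f : M →ₗ[R] N,
        (ϱN ∘ₗ f = (TensorProduct.map f LinearMap.id) ∘ₗ ϱM)
        ↔ (∀ (a : A) (m : M),
            f (inducedAction R β ϱM a m) = inducedAction R β ϱN a (f m))) := by
  have hα (M : Type u) [AddCommGroup M] [Module R M] :
      Function.Injective (alphaMap R β M) := fun t t' h =>
    eq_of_slice_eq (hlp M) hdense fun a => by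
      rw [← alphaMap_apply, h, alphaMap_apply]
  refine ⟨fun M _ _ ϱ hϱ _ m => ?_, fun M _ _ ϱ hϱ _ => ⟨inducedAction_mul hmeas hϱ,
    inducedAction_flip_injective hdense hϱ, fun m => ⟨ϱ m, rfl⟩⟩,
    fun M _ _ σ hmul hinj hrat => ?_, fun M _ _ ϱM N _ _ ϱN _ _ _ _ f => ?_⟩
  · obtain ⟨a, ha⟩ := exists_inducedAction_eq_self hdense hϱ m
    exact Submodule.subset_span ⟨a, m, ha⟩
  · let ϱ : M →ₗ[R] M ⊗[R] C :=
      (LinearEquiv.ofInjective _ (hα M)).symm.toLinearMap ∘ₗ σ.flip.codRestrict _ hrat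
    have hϱ : alphaMap R β M ∘ₗ ϱ = σ.flip := by
      ext1 m
      exact congrArg Subtype.val
        ((LinearEquiv.ofInjective _ (hα M)).apply_symm_apply ⟨σ.flip m, hrat m⟩)
    have hσ : inducedAction R β ϱ = σ := by rw [inducedAction, hϱ, LinearMap.flip_flip]
    refine ⟨ϱ, ⟨isRightComodule_of_inducedAction_mul hmeas hlp hdense ?_ ?_, ?_, hσ⟩, ?_⟩
    · rwa [hσ]
    · rwa [hσ]
    · rw [← hϱ, LinearMap.coe_comp] at hinj
      exact hinj.of_comp
    · rintro ϱ' ⟨-, -, h⟩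
      refine LinearMap.ext fun m => hα M ?_
      exact LinearMap.congr_fun (congrArg LinearMap.flip (h.trans hσ.symm)) m
  · simp only [inducedAction_apply, ← slice_map]
    exact ⟨fun h a m => congrArg (slice N (β a)) (LinearMap.congr_fun h m).symm,
      fun h => LinearMap.ext fun m => eq_of_slice_eq (hlp N) hdense fun a => (h a m).symm⟩
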